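/- Let F ∈ 𝓕₁(I) and let f ∈ 𝓕(I) be an iterative root of F of some order n ≥ 1 (i.e. f^n(x) = F(x) for all x ∈ I). Then for each subinterval I_i ∈ I(F) there is an integer j ∈ {0,1,…,m} such that f(I_i) ⊆ I_j. -/

import Mathlib

open Set Filter Topology

/-- Iterates of a multifunction: `Iter F 0 x = {x}`, `Iter F (n+1) x = F (Iter F n x)`. -/
def Iter (F : ℝ → Set ℝ) : ℕ → ℝ → Set ℝ
  | 0 => fun x => {x}
  | n + 1 => fun x => ⋃ y ∈ Iter F n x, F y

/-- Composition of multifunctions: `(G ∘ F)(x) = ⋃ y ∈ F x, G y`. -/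
def Comp (G F : ℝ → Set ℝ) : ℝ → Set ℝ := fun x => ⋃ y ∈ F x, G y

/-- Image of a set under a multifunction: `F(A) = ⋃ x ∈ A, F x`. -/
def ImageOf (F : ℝ → Set ℝ) (A : Set ℝ) : Set ℝ := ⋃ x ∈ A, F x

/-- `F` is a multifunction on `[a,b]`: nonempty compact values contained in `[a,b]`. -/
def MFOn (a b : ℝ) (F : ℝ → Set ℝ) : Prop :=
  ∀ x ∈ Icc a b, (F x).Nonempty ∧ IsCompact (F x) ∧ F x ⊆ Icc a b

/-- Upper semicontinuity of a multifunction at a point, relative to a domain `S`. -/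
def USCWithin (S : Set ℝ) (F : ℝ → Set ℝ) (x : ℝ) : Prop :=
  ∀ V : Set ℝ, IsOpen V → F x ⊆ V → ∃ U ∈ 𝓝 x, ∀ y ∈ U ∩ S, F y ⊆ V

/-- Upper semicontinuity on `[a,b]`. -/
def USCOn (a b : ℝ) (F : ℝ → Set ℝ) : Prop :=
  ∀ x ∈ Icc a b, USCWithin (Icc a b) F x

/-- Strictly increasing multifunction: `max F(x) < min F(y)` whenever `x < y` in `[a,b]`. -/
def SIncOn (a b : ℝ) (F : ℝ → Set ℝ) : Prop :=
  ∀ x ∈ Icc a b, ∀ y ∈ Icc a b, x < y → ∀ u ∈ F x, ∀ v ∈ F y, u < v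

/-- Strictly decreasing multifunction: `min F(x) > max F(y)` whenever `x < y` in `[a,b]`. -/
def SDecOn (a b : ℝ) (F : ℝ → Set ℝ) : Prop :=
  ∀ x ∈ Icc a b, ∀ y ∈ Icc a b, x < y → ∀ u ∈ F x, ∀ v ∈ F y, v < u

/-- The class 𝓕(I) of strictly monotone usc multifunctions on `I = [a,b]`. -/
def ClassF (a b : ℝ) (F : ℝ → Set ℝ) : Prop :=
  MFOn a b F ∧ USCOn a b F ∧ (SIncOn a b F ∨ SDecOn a b F)

/-- The set `J(F)` of jumps (set-valued points) of `F` in `[a,b]`. -/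
def Jumps (a b : ℝ) (F : ℝ → Set ℝ) : Set ℝ :=
  {x | x ∈ Icc a b ∧ (F x).Nontrivial}

/-- `k` is the intensity `ζ(F)`: the least `k` with `#J(F^k) = #J(F^{k+1})`. -/
def IsIntensity (a b : ℝ) (F : ℝ → Set ℝ) (k : ℕ) : Prop :=
  IsLeast {j : ℕ | (Jumps a b (Iter F j)).ncard = (Jumps a b (Iter F (j + 1))).ncard} k

/-- Exclusive multifunctions 𝓕₁(I): members of 𝓕(I) with finitely many jumps and intensity 1. -/
def Exclusive (a b : ℝ) (F : ℝ → Set ℝ) : Prop :=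
  ClassF a b F ∧ (Jumps a b F).Finite ∧ IsIntensity a b F 1

/-- Enumeration of the jumps: `c 0 = a`, `c (m+1) = b`, `c` strictly increasing on `{0,…,m+1}`,
and the jumps of `F` are exactly `c 1 < … < c m`.  The subintervals are `I_i = (c i, c (i+1))`. -/
def JumpEnum (a b : ℝ) (F : ℝ → Set ℝ) (m : ℕ) (c : ℕ → ℝ) : Prop :=
  c 0 = a ∧ c (m + 1) = b ∧ (∀ i j : ℕ, i < j → j ≤ m + 1 → c i < c j) ∧
    Jumps a b F = {x | ∃ i : ℕ, 1 ≤ i ∧ i ≤ m ∧ x = c i}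

/-- Hypothesis (H): `F` is strictly increasing, `max F(x) < x` on `(a,b)`, and `max F(b) ≤ b`. -/
def HypH (a b : ℝ) (F : ℝ → Set ℝ) : Prop :=
  SIncOn a b F ∧ (∀ x ∈ Ioo a b, ∀ u ∈ F x, u < x) ∧ (∀ u ∈ F b, u ≤ b)

theorem iter_add (f : ℝ → Set ℝ) (p q : ℕ) (x : ℝ) :
    Iter f (p + q) x = ⋃ y ∈ Iter f p x, Iter f q y := by
  induction q with
  | zero => simp [Iter]
  | succ q ih =>
    change ⋃ y ∈ Iter f (p + q) x, f y = _
    rw [ih]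
    ext z
    simp only [Iter, mem_iUnion, exists_prop]
    grind

theorem iter_two (F : ℝ → Set ℝ) (x : ℝ) : Iter F 2 x = ⋃ y ∈ F x, F y := by
  simp [Iter]

theorem ClassF.values_disjoint {a b : ℝ} {f : ℝ → Set ℝ} (hf : ClassF a b f) {x y u : ℝ}
    (hx : x ∈ Icc a b) (hy : y ∈ Icc a b) (hux : u ∈ f x) (huy : u ∈ f y) : x = y := by
  obtain ⟨-, -, h | h⟩ := hf <;> rcases lt_trichotomy x y with hxy | hxy | hxy
  · exact absurd (h x hx y hy hxy u hux u huy) (lt_irrefl u)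
  · exact hxy
  · exact absurd (h y hy x hx hxy u huy u hux) (lt_irrefl u)
  · exact absurd (h x hx y hy hxy u hux u huy) (lt_irrefl u)
  · exact hxy
  · exact absurd (h y hy x hx hxy u huy u hux) (lt_irrefl u)

theorem ClassF.image_nontrivial {a b : ℝ} {f : ℝ → Set ℝ} (hf : ClassF a b f) {A : Set ℝ}
    (hA : A ⊆ Icc a b) (hn : A.Nontrivial) : (⋃ y ∈ A, f y).Nontrivial := by
  obtain ⟨x, hx, y, hy, hxy⟩ := hn
  obtain ⟨u, hu⟩ := (hf.1 x (hA hx)).1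
  obtain ⟨v, hv⟩ := (hf.1 y (hA hy)).1
  refine ⟨u, mem_biUnion hx hu, v, mem_biUnion hy hv, ?_⟩
  rintro rfl
  exact hxy (hf.values_disjoint (hA hx) (hA hy) hu hv)

theorem ClassF.iter_subset {a b : ℝ} {f : ℝ → Set ℝ} (hf : ClassF a b f) {x : ℝ}
    (hx : x ∈ Icc a b) (k : ℕ) : Iter f k x ⊆ Icc a b := by
  induction k with
  | zero => simpa [Iter] using hx
  | succ k ih => exact iUnion₂_subset fun y hy => (hf.1 y (ih hy)).2.2

theorem ClassF.iter_nontrivial_mono {a b : ℝ} {f : ℝ → Set ℝ} (hf : ClassF a b f) {x : ℝ}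
    (hx : x ∈ Icc a b) {k l : ℕ} (hkl : k ≤ l) (hk : (Iter f k x).Nontrivial) :
    (Iter f l x).Nontrivial := by
  induction l, hkl using Nat.le_induction with
  | base => exact hk
  | succ l _ ih => exact hf.image_nontrivial (hf.iter_subset hx l) ih

theorem Exclusive.jumps_iter_two {a b : ℝ} {F : ℝ → Set ℝ} (hF : Exclusive a b F) :
    Jumps a b (Iter F 2) = Jumps a b F := by
  obtain ⟨hC, hfin, hint, -⟩ := hF
  have h1 : Iter F 1 = F := by
    funext x
    simp [Iter]
  have hcard : (Jumps a b F).ncard = (Jumps a b (Iter F 2)).ncard := by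
    simpa only [mem_ofPred_eq, h1] using hint
  have hfin₂ : (Jumps a b (Iter F 2)).Finite := by
    have hpre : (⋃ d ∈ Jumps a b F, {x | x ∈ Icc a b ∧ d ∈ F x}).Finite :=
      hfin.biUnion fun d _ => Set.Subsingleton.finite fun x hx y hy =>
        hC.values_disjoint hx.1 hy.1 hx.2 hy.2
    refine (hfin.union hpre).subset ?_
    rintro x ⟨hx, hx2⟩
    by_cases hxF : (F x).Nontrivial
    · exact Or.inl ⟨hx, hxF⟩
    · obtain ⟨y, hy⟩ := (hC.1 x hx).1
      have hs : F x = {y} := (not_nontrivial_iff.1 hxF).eq_singleton_of_mem hy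
      rw [iter_two, hs, biUnion_singleton] at hx2
      exact Or.inr (mem_biUnion (x := y) ⟨(hC.1 x hx).2.2 hy, hx2⟩ ⟨hx, hy⟩)
  refine (eq_of_subset_of_ncard_le ?_ hcard.ge hfin₂).symm
  rintro x ⟨hx, hxF⟩
  refine ⟨hx, ?_⟩
  rw [iter_two]
  exact hC.image_nontrivial (hC.1 x hx).2.2 hxF

theorem JumpEnum.mono {a b : ℝ} {F : ℝ → Set ℝ} {m : ℕ} {c : ℕ → ℝ} (hc : JumpEnum a b F m c)
    {i j : ℕ} (hij : i ≤ j) (hj : j ≤ m + 1) : c i ≤ c j := by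
  rcases hij.eq_or_lt with rfl | h
  · exact le_rfl
  · exact (hc.2.2.1 i j h hj).le

theorem JumpEnum.notMem_jumps {a b : ℝ} {F : ℝ → Set ℝ} {m : ℕ} {c : ℕ → ℝ}
    (hc : JumpEnum a b F m c) {i : ℕ} (hi : i ≤ m) {x : ℝ} (hx : x ∈ Ioo (c i) (c (i + 1))) :
    x ∉ Jumps a b F := by
  rw [hc.2.2.2]
  rintro ⟨k, -, hk, rfl⟩
  rcases Nat.lt_or_ge i k with h | h
  · exact absurd hx.2 (hc.mono h (by omega)).not_gt
  · exact absurd hx.1 (hc.mono h (by omega)).not_gt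

theorem JumpEnum.Ioo_subset {a b : ℝ} {F : ℝ → Set ℝ} {m : ℕ} {c : ℕ → ℝ}
    (hc : JumpEnum a b F m c) {i : ℕ} (hi : i ≤ m) : Ioo (c i) (c (i + 1)) ⊆ Ioo a b :=
  Ioo_subset_Ioo (hc.1 ▸ hc.mono (Nat.zero_le i) (by omega))
    (hc.2.1 ▸ hc.mono (by omega) le_rfl)

/-- An order-connected subset of `(a, b)` avoiding the jumps lies in a single subinterval. -/
theorem JumpEnum.exists_subset_Ioo {a b : ℝ} {F : ℝ → Set ℝ} {m : ℕ} {c : ℕ → ℝ}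
    (hc : JumpEnum a b F m c) {S : Set ℝ} (hS : S.OrdConnected) (hSab : S ⊆ Ioo a b)
    (hSJ : Disjoint S (Jumps a b F)) : ∃ j ≤ m, S ⊆ Ioo (c j) (c (j + 1)) := by
  have havoid : ∀ k ≤ m + 1, c k ∉ S := by
    intro k hk hmem
    rcases Nat.eq_zero_or_pos k with rfl | h0
    · exact (hSab hmem).1.ne hc.1.symm
    rcases hk.eq_or_lt with rfl | h1
    · exact (hSab hmem).2.ne hc.2.1
    · refine disjoint_left.1 hSJ hmem ?_
      rw [hc.2.2.2]
      exact ⟨k, h0, by omega, rfl⟩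
  rcases S.eq_empty_or_nonempty with rfl | ⟨s, hs⟩
  · exact ⟨0, Nat.zero_le m, empty_subset _⟩
  classical
  have hex : ∃ k, s < c k := ⟨m + 1, hc.2.1 ▸ (hSab hs).2⟩
  have hle : Nat.find hex ≤ m + 1 := Nat.find_min' hex (hc.2.1 ▸ (hSab hs).2)
  have hpos : Nat.find hex ≠ 0 := by
    intro h
    have := Nat.find_spec hex
    rw [h, hc.1] at this
    exact this.not_gt (hSab hs).1
  obtain ⟨j, hj⟩ := Nat.exists_eq_succ_of_ne_zero hpos
  have hjs : c j ≤ s := not_lt.1 (Nat.find_min hex (by omega))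
  have hsj : s < c (j + 1) := by
    have := Nat.find_spec hex
    rwa [hj] at this
  refine ⟨j, by omega, fun t ht => ⟨?_, ?_⟩⟩
  · by_contra! h
    exact havoid j (by omega) (hS.out ht hs ⟨h, hjs⟩)
  · by_contra! h
    exact havoid (j + 1) (by omega) (hS.out hs ht ⟨hsj.le, h⟩)

theorem ClassF.subset_Ioo {a b : ℝ} {f : ℝ → Set ℝ} (hf : ClassF a b f) {x : ℝ}
    (hx : x ∈ Ioo a b) : f x ⊆ Ioo a b := by
  intro y hy
  have hxI := Ioo_subset_Icc_self hx
  have hab := hx.1.trans hx.2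
  have ha : a ∈ Icc a b := left_mem_Icc.2 hab.le
  have hb : b ∈ Icc a b := right_mem_Icc.2 hab.le
  obtain ⟨u, hu⟩ := (hf.1 a ha).1
  obtain ⟨v, hv⟩ := (hf.1 b hb).1
  have hu' := (hf.1 a ha).2.2 hu
  have hv' := (hf.1 b hb).2.2 hv
  obtain ⟨-, -, h | h⟩ := hf
  · exact ⟨hu'.1.trans_lt (h a ha x hxI hx.1 u hu y hy),
      (h x hxI b hb hx.2 y hy v hv).trans_le hv'.2⟩
  · exact ⟨hv'.1.trans_lt (h x hxI b hb hx.2 y hy v hv),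
      (h a ha x hxI hx.1 u hu y hy).trans_le hu'.2⟩

/-- The image of an interval on which an usc multifunction is single-valued is an interval. -/
theorem ClassF.ordConnected_imageOf {a b : ℝ} {f : ℝ → Set ℝ} (hf : ClassF a b f) {T : Set ℝ}
    (hT : T ⊆ Icc a b) (hTc : T.OrdConnected) (hs : ∀ x ∈ T, (f x).Subsingleton) :
    (ImageOf f T).OrdConnected := by
  choose! g hg using fun x hx => (hf.1 x hx).1
  have hfg : ∀ x ∈ T, f x = {g x} := fun x hx =>
    (hs x hx).eq_singleton_of_mem (hg x (hT hx))
  have hcont : ContinuousOn g T := by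
    intro x hx
    rw [ContinuousWithinAt, tendsto_nhds]
    intro V hV hxV
    obtain ⟨U, hU, hUV⟩ := hf.2.1 x (hT hx) V hV (by simpa [hfg x hx] using hxV)
    filter_upwards [mem_nhdsWithin_of_mem_nhds hU, self_mem_nhdsWithin] with y hyU hyT
    exact hUV y ⟨hyU, hT hyT⟩ (hg y (hT hyT))
  have himg : ImageOf f T = g '' T := by
    rw [ImageOf, iUnion₂_congr hfg]
    ext y
    simp [eq_comm]
  rw [himg]
  exact (hTc.isPreconnected.image g hcont).ordConnected

/-- an iterative root `f ∈ 𝓕(I)` of `F ∈ 𝓕₁(I)` maps each subinterval `I_i`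
into some subinterval `I_j`. -/
theorem stmt7 (a b : ℝ) (hab : a < b) (F : ℝ → Set ℝ) (hF : Exclusive a b F)
    (m : ℕ) (c : ℕ → ℝ) (hc : JumpEnum a b F m c)
    (f : ℝ → Set ℝ) (hf : ClassF a b f) (n : ℕ) (hn : 1 ≤ n)
    (hroot : ∀ x ∈ Icc a b, Iter f n x = F x) :
    ∀ i ≤ m, ∃ j ≤ m,
      ImageOf f (Ioo (c i) (c (i + 1))) ⊆ Ioo (c j) (c (j + 1)) := by
  obtain ⟨hC, -, -⟩ := id hF
  have hsingle : ∀ x ∈ Icc a b, x ∉ Jumps a b F → ∀ k ≤ n + n, ¬ (Iter f k x).Nontrivial := by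
    intro x hx hxJ k hk hnt
    rw [← hF.jumps_iter_two] at hxJ
    refine hxJ ⟨hx, ?_⟩
    have h := hf.iter_nontrivial_mono hx hk hnt
    rw [iter_add, hroot x hx] at h
    rwa [iter_two, ← iUnion₂_congr fun y hy => hroot y ((hC.1 x hx).2.2 hy)]
  intro i hi
  have hI : Ioo (c i) (c (i + 1)) ⊆ Icc a b := (hc.Ioo_subset hi).trans Ioo_subset_Icc_self
  have hf1 : ∀ x, Iter f 1 x = f x := fun x => by simp [Iter]
  refine hc.exists_subset_Ioo (hf.ordConnected_imageOf hI ordConnected_Ioo fun x hx => ?_)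
    (iUnion₂_subset fun x hx => hf.subset_Ioo (hc.Ioo_subset hi hx)) ?_
  · rw [← hf1]
    exact not_nontrivial_iff.1 (hsingle x (hI hx) (hc.notMem_jumps hi hx) 1 (by omega))
  · rw [disjoint_left]
    rintro y hy ⟨hyI, hyF⟩
    obtain ⟨x, hx, hyx⟩ := mem_iUnion₂.1 hy
    refine hsingle x (hI hx) (hc.notMem_jumps hi hx) (1 + n) (by omega) ?_
    rw [iter_add, hf1]
    rw [← hroot y hyI] at hyF
    exact hyF.mono (subset_biUnion_of_mem (u := fun y => Iter f n y) hyx)
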